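/- arXiv:2306.00761 — 3 statements merged into one kernel-verified Lean document; each statement's English description precedes it below -/
import Mathlib

section
/- Let R, b > 0, let Ω = (-R,R) × (-R,R) × (-b,b) ⊂ ℝ³, and let r > b. Define the Carleman weight μ_λ(z) = exp(-λ(R+r)²)·exp(λ(z-r)²). Then there exist constants λ₀ = λ₀(R,b,r) ≥ 1 and C = C(R,b,r) > 0 such that for every λ ≥ λ₀ and every smooth function V : ℝ³ → ℂ with compact support contained in Ω, one has ∫_Ω μ_λ(z)|ΔV|² dx ≥ (C/λ) ∫_Ω μ_λ(z)(|∂²_{xx}V|² + |∂²_{yy}V|² + |∂²_{zz}V|² + |∂²_{xy}V|² + |∂²_{yz}V|² + |∂²_{xz}V|²) dx + Cλ ∫_Ω μ_λ(z)(|∇V|² + λ²|V|²) dx. -/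
open MeasureTheory

noncomputable section

abbrev E3 : Type := EuclideanSpace ℝ (Fin 3)

/-- Partial derivative of `W` in the `i`-th coordinate direction. -/
def pd (i : Fin 3) (W : E3 → ℂ) (x : E3) : ℂ :=
  fderiv ℝ W x (EuclideanSpace.single i 1)

/-- The Laplacian of `W`. -/
def lap (W : E3 → ℂ) (x : E3) : ℂ :=
  pd 0 (pd 0 W) x + pd 1 (pd 1 W) x + pd 2 (pd 2 W) x

open scoped ContDiff

/-- Partial derivative of a real-valued function in the `i`-th coordinate direction. -/
def rpd (i : Fin 3) (f : E3 → ℝ) (x : E3) : ℝ :=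
  fderiv ℝ f x (EuclideanSpace.single i 1)

section PartialDerivatives

variable {i j : Fin 3} {f g : E3 → ℝ} {x : E3}

lemma rpd_add (hf : Differentiable ℝ f) (hg : Differentiable ℝ g) :
    rpd i (fun y ↦ f y + g y) x = rpd i f x + rpd i g x := by
  simp [rpd, fderiv_fun_add (hf x) (hg x)]

lemma rpd_sub (hf : Differentiable ℝ f) (hg : Differentiable ℝ g) :
    rpd i (fun y ↦ f y - g y) x = rpd i f x - rpd i g x := by
  simp [rpd, fderiv_fun_sub (hf x) (hg x)]

lemma rpd_mul (hf : Differentiable ℝ f) (hg : Differentiable ℝ g) :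
    rpd i (fun y ↦ f y * g y) x = rpd i f x * g x + f x * rpd i g x := by
  simp [rpd, fderiv_fun_mul (hf x) (hg x)]
  ring

lemma rpd_const (c : ℝ) : rpd i (fun _ ↦ c) x = 0 := by
  simp [rpd]

lemma rpd_coord (i j : Fin 3) (x : E3) :
    rpd i (fun y ↦ y j) x = if j = i then 1 else 0 := by
  have h : HasFDerivAt (fun y : E3 ↦ y j) (EuclideanSpace.proj j : E3 →L[ℝ] ℝ) x :=
    (EuclideanSpace.proj j : E3 →L[ℝ] ℝ).hasFDerivAt
  simp [rpd, h.fderiv]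

lemma rpd_exp (hf : Differentiable ℝ f) :
    rpd i (fun y ↦ Real.exp (f y)) x = Real.exp (f x) * rpd i f x := by
  simp [rpd, fderiv_exp (hf x)]

lemma contDiff_rpd (i : Fin 3) (hf : ContDiff ℝ ∞ f) : ContDiff ℝ ∞ (rpd i f) :=
  (hf.fderiv_right (m := ∞) (by simp)).clm_apply contDiff_const

lemma rpd_comm (i j : Fin 3) (hf : ContDiff ℝ ∞ f) :
    rpd i (rpd j f) = rpd j (rpd i f) := by
  funext x
  have hd : DifferentiableAt ℝ (fderiv ℝ f) x :=
    ((hf.fderiv_right (m := ∞) (by simp)).differentiable (by simp)) x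
  have key (i j : Fin 3) : rpd i (rpd j f) x =
      fderiv ℝ (fderiv ℝ f) x (EuclideanSpace.single i 1) (EuclideanSpace.single j 1) := by
    unfold rpd
    rw [fderiv_clm_apply hd (differentiableAt_const _)]
    simp
  have hs : IsSymmSndFDerivAt ℝ f x :=
    hf.contDiffAt.isSymmSndFDerivAt (by simpa using WithTop.coe_le_coe.2 (le_top (a := (2 : ℕ∞))))
  rw [key, key, hs.eq]

end PartialDerivatives

/-- Smooth functions with compact support inside `U`. -/
structure IsTest (U : Set E3) (f : E3 → ℝ) : Prop where
  contDiff : ContDiff ℝ ∞ f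
  hasCompactSupport : HasCompactSupport f
  tsupport_subset : tsupport f ⊆ U

namespace IsTest

variable {U : Set E3} {f g : E3 → ℝ}

lemma mul (hf : IsTest U f) (hg : ContDiff ℝ ∞ g) : IsTest U (fun x ↦ f x * g x) :=
  ⟨hf.contDiff.mul hg, hf.hasCompactSupport.mul_right,
    (tsupport_mul_subset_left (f := f) (g := g)).trans hf.tsupport_subset⟩

lemma mul' (hf : IsTest U f) (hg : ContDiff ℝ ∞ g) : IsTest U (fun x ↦ g x * f x) := by
  simpa only [mul_comm] using hf.mul hg

lemma add (hf : IsTest U f) (hg : IsTest U g) : IsTest U (fun x ↦ f x + g x) :=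
  ⟨hf.contDiff.add hg.contDiff, hf.hasCompactSupport.add hg.hasCompactSupport,
    (tsupport_add f g).trans (Set.union_subset hf.tsupport_subset hg.tsupport_subset)⟩

lemma rpd (i : Fin 3) (hf : IsTest U f) : IsTest U (rpd i f) :=
  ⟨contDiff_rpd i hf.contDiff, hf.hasCompactSupport.fderiv_apply (𝕜 := ℝ) _,
    (tsupport_fderiv_apply_subset ℝ _).trans hf.tsupport_subset⟩

lemma integrable (hf : IsTest U f) : Integrable f :=
  hf.contDiff.continuous.integrable_of_hasCompactSupport hf.hasCompactSupport

lemma setIntegral_rpd (i : Fin 3) (hf : IsTest U f) : ∫ x in U, _root_.rpd i f x = 0 := by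
  rw [setIntegral_eq_integral_of_forall_compl_eq_zero fun x hx ↦
    image_eq_zero_of_notMem_tsupport fun h ↦ hx ((hf.rpd i).tsupport_subset h)]
  have h := integral_mul_fderiv_eq_neg_fderiv_mul_of_integrable (μ := (volume : Measure E3))
    (f := fun _ ↦ (1 : ℝ)) (g := f) (v := EuclideanSpace.single i 1) (by simp)
    (by simpa using! (hf.rpd i).integrable) (by simpa using hf.integrable)
    (fun _ _ ↦ differentiableAt_const _)
    (fun x _ ↦ hf.contDiff.differentiable (by simp) x)
  simpa [_root_.rpd] using h

end IsTest

lemma second_order_pointwise {l q N w w0 w1 w2 w00 w11 w22 w01 w12 w02 : ℝ} (hl : 1 ≤ l)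
    (hlq : 1 ≤ l * q ^ 2) (hqN : q ^ 2 ≤ N) :
    (w00 ^ 2 + w11 ^ 2 + (w22 - 2 * l * q * w2 + (l ^ 2 * q ^ 2 - l) * w) ^ 2
        + w01 ^ 2 + (w12 - l * q * w1) ^ 2 + (w02 - l * q * w0) ^ 2) / l
      + 6 * ((w00 * w11 - w01 ^ 2) + (w00 * w22 - w02 ^ 2) + (w11 * w22 - w12 ^ 2)) / l
      ≤ 6 * (w00 + w11 + w22 + l ^ 2 * q ^ 2 * w) ^ 2
        + 12 * N * (l * (w0 ^ 2 + w1 ^ 2 + w2 ^ 2)) + 9 * (N * (l ^ 3 * q ^ 2 * w ^ 2)) := by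
  have hl0 : 0 < l := by linarith
  have hsub (a b : ℝ) : (a - b) ^ 2 ≤ 2 * a ^ 2 + 2 * b ^ 2 := by
    nlinarith [sq_nonneg (a + b)]
  have h1 : (l ^ 2 * q ^ 2 - l) ^ 2 * w ^ 2 ≤ l ^ 4 * q ^ 4 * w ^ 2 := by
    have : 0 ≤ l ^ 2 * w ^ 2 * (2 * (l * q ^ 2) - 1) := mul_nonneg (by positivity) (by linarith)
    linarith
  have h2 : (w22 - 2 * l * q * w2 + (l ^ 2 * q ^ 2 - l) * w) ^ 2 ≤
      3 * w22 ^ 2 + 12 * (l ^ 2 * q ^ 2 * w2 ^ 2) + 3 * ((l ^ 2 * q ^ 2 - l) ^ 2 * w ^ 2) := by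
    have (a b c : ℝ) : (a - b + c) ^ 2 ≤ 3 * a ^ 2 + 3 * b ^ 2 + 3 * c ^ 2 := by
      nlinarith [sq_nonneg (a + b), sq_nonneg (a - c), sq_nonneg (b + c)]
    refine (this w22 (2 * l * q * w2) ((l ^ 2 * q ^ 2 - l) * w)).trans_eq ?_
    ring
  have h3 := hsub w12 (l * q * w1)
  have h4 := hsub w02 (l * q * w0)
  have h5 : l ^ 2 * q ^ 2 * (w0 ^ 2 + w1 ^ 2 + w2 ^ 2) ≤
      N * (l ^ 2 * (w0 ^ 2 + w1 ^ 2 + w2 ^ 2)) := by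
    have : 0 ≤ (N - q ^ 2) * (l ^ 2 * (w0 ^ 2 + w1 ^ 2 + w2 ^ 2)) :=
      mul_nonneg (by linarith) (by positivity)
    linarith
  have h5a : 0 ≤ l ^ 2 * q ^ 2 * w0 ^ 2 := by positivity
  have h5b : 0 ≤ l ^ 2 * q ^ 2 * w1 ^ 2 := by positivity
  have h6 : (w00 + w11 + w22) ^ 2 ≤ 2 * (w00 + w11 + w22 + l ^ 2 * q ^ 2 * w) ^ 2
      + 2 * (l ^ 4 * q ^ 4 * w ^ 2) := by
    refine le_of_eq_of_le ?_ ((hsub (w00 + w11 + w22 + l ^ 2 * q ^ 2 * w)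
      (l ^ 2 * q ^ 2 * w)).trans_eq ?_) <;> ring
  have h7 : (w00 + w11 + w22 + l ^ 2 * q ^ 2 * w) ^ 2 ≤
      l * (w00 + w11 + w22 + l ^ 2 * q ^ 2 * w) ^ 2 := le_mul_of_one_le_left (sq_nonneg _) hl
  have h8 : l ^ 4 * q ^ 4 * w ^ 2 ≤ N * (l ^ 4 * q ^ 2 * w ^ 2) := by
    have : 0 ≤ (N - q ^ 2) * (l ^ 4 * q ^ 2 * w ^ 2) := mul_nonneg (by linarith) (by positivity)
    linarith
  rw [← add_div, div_le_iff₀' hl0]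
  generalize (w00 + w11 + w22 + l ^ 2 * q ^ 2 * w) ^ 2 = T at *
  linarith [sq_nonneg w00, sq_nonneg w11, sq_nonneg w01, sq_nonneg w12, sq_nonneg w02]

/-- The pointwise inequality: `w` and its derivatives up to order two are treated as independent
variables, and the last term is the divergence that integrates to zero. -/
lemma carleman_pointwise {l q N K w w0 w1 w2 w00 w11 w22 w01 w12 w02 : ℝ} (hl : 1 ≤ l)
    (hlq : 1 ≤ l * q ^ 2) (hqN : q ^ 2 ≤ N) (hK : 0 ≤ K) (hKq : 1 ≤ K * q ^ 2) :
    (12 + 12 * N + K)⁻¹ / l * (w00 ^ 2 + w11 ^ 2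
        + (w22 - 2 * l * q * w2 + (l ^ 2 * q ^ 2 - l) * w) ^ 2
        + w01 ^ 2 + (w12 - l * q * w1) ^ 2 + (w02 - l * q * w0) ^ 2)
      + (12 + 12 * N + K)⁻¹ * l * ((w0 ^ 2 + w1 ^ 2 + (w2 - l * q * w) ^ 2) + l ^ 2 * w ^ 2)
      + (2 * ((w00 + w11 + w22 + l ^ 2 * q ^ 2 * w) * (-2 * l * q * w2 - l * w)
            - 2 * l * w2 ^ 2 - 2 * l ^ 3 * q ^ 2 * w ^ 2)
          - l * (w0 ^ 2 + w1 ^ 2 + w2 ^ 2 + w * (w00 + w11 + w22))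
          + 6 * (12 + 12 * N + K)⁻¹ / l * ((w00 * w11 - w01 ^ 2) + (w00 * w22 - w02 ^ 2)
            + (w11 * w22 - w12 ^ 2))) ≤
    (w00 + w11 + (w22 - 2 * l * q * w2 + (l ^ 2 * q ^ 2 - l) * w)) ^ 2 := by
  have hN : 0 ≤ N := (sq_nonneg q).trans hqN
  have hl0 : 0 < l := by linarith
  set C := (12 + 12 * N + K)⁻¹ with hC
  have hC0 : 0 < C := by positivity
  have hC1 : C * (12 + 12 * N + K) = 1 := inv_mul_cancel₀ (by positivity)
  set S := w00 + w11 + w22 + l ^ 2 * q ^ 2 * w with hS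
  set X := l ^ 3 * q ^ 2 * w ^ 2 with hX
  set G := l * (w0 ^ 2 + w1 ^ 2 + w2 ^ 2) with hG
  have hX0 : 0 ≤ X := by positivity
  have hG0 : 0 ≤ G := by positivity
  have hKX : l ^ 3 * w ^ 2 ≤ K * X := by
    have : 0 ≤ (K * q ^ 2 - 1) * (l ^ 3 * w ^ 2) := mul_nonneg (by linarith) (by positivity)
    rw [hX]; linarith
  have hlX : l ^ 2 * w ^ 2 ≤ X := by
    have : 0 ≤ (l * q ^ 2 - 1) * (l ^ 2 * w ^ 2) := mul_nonneg (by linarith) (by positivity)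
    rw [hX]; linarith
  have second := second_order_pointwise (w := w) (w0 := w0) (w1 := w1) (w2 := w2) (w00 := w00)
    (w11 := w11) (w22 := w22) (w01 := w01) (w12 := w12) (w02 := w02) hl hlq hqN
  rw [← hS, ← hG, ← hX] at second
  have first : l * ((w0 ^ 2 + w1 ^ 2 + (w2 - l * q * w) ^ 2) + l ^ 2 * w ^ 2) ≤
      2 * G + 2 * X + K * X := by
    have : 0 ≤ l * ((w2 + l * q * w) ^ 2 + w0 ^ 2 + w1 ^ 2) := by positivity
    rw [hX] at hKX
    rw [hG, hX]
    linarith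
  have lower : 1 / 2 * S ^ 2 + G + 2 * X ≤ S ^ 2 + (4 * l * w2 ^ 2 + 4 * X)
      + l * (w0 ^ 2 + w1 ^ 2 + w2 ^ 2 + w * (w00 + w11 + w22)) := by
    have h1 : l * (w * (w00 + w11 + w22)) = l * w * S - X := by rw [hS, hX]; ring
    have h2 : -(1 / 2 * S ^ 2 + 1 / 2 * (l ^ 2 * w ^ 2)) ≤ l * w * S := by
      nlinarith [sq_nonneg (S + l * w)]
    have h3 : 0 ≤ l * w2 ^ 2 := by positivity
    rw [mul_add l (_ + _), h1]
    linarith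
  have combine : C * (6 * S ^ 2 + 12 * N * G + 9 * (N * X)) + C * (2 * G + 2 * X + K * X) ≤
      1 / 2 * S ^ 2 + G + 2 * X := by
    have a1 : 0 ≤ C * N := by positivity
    have a2 : 0 ≤ C * K := by positivity
    have b1 : C * 6 ≤ 1 / 2 := by linarith
    have b2 : C * (12 * N + 2) ≤ 1 := by linarith
    have b3 : C * (9 * N + 2 + K) ≤ 2 := by linarith
    linarith [mul_le_mul_of_nonneg_right b1 (sq_nonneg S), mul_le_mul_of_nonneg_right b2 hG0,
      mul_le_mul_of_nonneg_right b3 hX0]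
  have m1 := mul_le_mul_of_nonneg_left second hC0.le
  have m2 := mul_le_mul_of_nonneg_left first hC0.le
  have e : (w00 + w11 + (w22 - 2 * l * q * w2 + (l ^ 2 * q ^ 2 - l) * w)) ^ 2 =
      S ^ 2 + 2 * (S * (-2 * l * q * w2 - l * w)) + (-2 * l * q * w2 - l * w) ^ 2 := by
    rw [hS]; ring
  have e3 : 2 * l ^ 3 * q ^ 2 * w ^ 2 = 2 * X := by rw [hX]; ring
  rw [e, e3]
  have hA := sq_nonneg (-2 * l * q * w2 - l * w)
  have r1 : ∀ a : ℝ, C / l * a = C * (a / l) := fun a ↦ by ring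
  have r2 : ∀ a : ℝ, 6 * C / l * a = C * (6 * a / l) := fun a ↦ by ring
  rw [r1, r2, mul_assoc C l]
  linarith

/-- The divergence of the vector field produced by the Carleman integrations by parts. -/
lemma setIntegral_carleman_divergence {U : Set E3} {w : E3 → ℝ} (hw : IsTest U w) (l r c : ℝ) :
    ∃ G : E3 → ℝ, IntegrableOn G U ∧ ∫ x in U, G x = 0 ∧ ∀ x, G x =
      2 * ((rpd 0 (rpd 0 w) x + rpd 1 (rpd 1 w) x + rpd 2 (rpd 2 w) x
              + l ^ 2 * (x 2 - r) ^ 2 * w x) * (-2 * l * (x 2 - r) * rpd 2 w x - l * w x)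
            - 2 * l * rpd 2 w x ^ 2 - 2 * l ^ 3 * (x 2 - r) ^ 2 * w x ^ 2)
          - l * (rpd 0 w x ^ 2 + rpd 1 w x ^ 2 + rpd 2 w x ^ 2
              + w x * (rpd 0 (rpd 0 w) x + rpd 1 (rpd 1 w) x + rpd 2 (rpd 2 w) x))
          + c * ((rpd 0 (rpd 0 w) x * rpd 1 (rpd 1 w) x - rpd 0 (rpd 1 w) x ^ 2)
            + (rpd 0 (rpd 0 w) x * rpd 2 (rpd 2 w) x - rpd 0 (rpd 2 w) x ^ 2)
            + (rpd 1 (rpd 1 w) x * rpd 2 (rpd 2 w) x - rpd 1 (rpd 2 w) x ^ 2)) := by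
  have hs := hw.contDiff
  have hs1 (i : Fin 3) : ContDiff ℝ ∞ (rpd i w) := contDiff_rpd i hs
  have hs2 (i j : Fin 3) : ContDiff ℝ ∞ (rpd i (rpd j w)) := contDiff_rpd i (hs1 j)
  have hd : Differentiable ℝ w := hs.differentiable (by simp)
  have hd1 (i : Fin 3) : Differentiable ℝ (rpd i w) := (hs1 i).differentiable (by simp)
  have hd2 (i j : Fin 3) : Differentiable ℝ (rpd i (rpd j w)) :=
    (hs2 i j).differentiable (by simp)
  have hF0 : IsTest U (fun x ↦ rpd 0 w x * (-4 * l * (x 2 - r) * rpd 2 w x - 3 * l * w x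
      + c * (rpd 1 (rpd 1 w) x + rpd 2 (rpd 2 w) x))) :=
    (hw.rpd 0).mul (by fun_prop)
  have hF1 : IsTest U (fun x ↦ rpd 1 w x * (-4 * l * (x 2 - r) * rpd 2 w x - 3 * l * w x
      + c * rpd 2 (rpd 2 w) x) + rpd 0 w x * (-c * rpd 0 (rpd 1 w) x)) :=
    ((hw.rpd 1).mul (by fun_prop)).add ((hw.rpd 0).mul (by fun_prop))
  have hF2 : IsTest U (fun x ↦ rpd 2 w x * (-2 * l * (x 2 - r) * rpd 2 w x - 3 * l * w x)
      + rpd 0 w x * (2 * l * (x 2 - r) * rpd 0 w x - c * rpd 0 (rpd 2 w) x)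
      + rpd 1 w x * (2 * l * (x 2 - r) * rpd 1 w x - c * rpd 1 (rpd 2 w) x)
      + w x * (-2 * l ^ 3 * ((x 2 - r) * ((x 2 - r) * (x 2 - r))) * w x)) :=
    ((((hw.rpd 2).mul (by fun_prop)).add ((hw.rpd 0).mul (by fun_prop))).add
      ((hw.rpd 1).mul (by fun_prop))).add (hw.mul (by fun_prop))
  have hi0 := (hF0.rpd 0).integrable.integrableOn (s := U)
  have hi1 := (hF1.rpd 1).integrable.integrableOn (s := U)
  have hi2 := (hF2.rpd 2).integrable.integrableOn (s := U)
  refine ⟨_, (hi0.add hi1).add hi2, ?_, fun x ↦ ?_⟩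
  · rw [integral_add' (hi0.add hi1) hi2, integral_add' hi0 hi1, hF0.setIntegral_rpd,
      hF1.setIntegral_rpd, hF2.setIntegral_rpd]
    simp
  · simp (disch := fun_prop) only [Pi.add_apply, rpd_add, rpd_sub, rpd_mul, rpd_const, rpd_coord]
    rw [rpd_comm 1 0 hs, rpd_comm 2 0 hs, rpd_comm 2 1 hs, rpd_comm 1 0 (hs1 1),
      rpd_comm 2 0 (hs1 2), rpd_comm 2 1 (hs1 2)]
    simp
    ring

/-- Weighted density of the squared Laplacian. -/
def lapDensity (ρ u : E3 → ℝ) (x : E3) : ℝ :=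
  ρ x * (rpd 0 (rpd 0 u) x + rpd 1 (rpd 1 u) x + rpd 2 (rpd 2 u) x) ^ 2

/-- Weighted density of the squared second derivatives. -/
def hessDensity (ρ u : E3 → ℝ) (x : E3) : ℝ :=
  ρ x * (rpd 0 (rpd 0 u) x ^ 2 + rpd 1 (rpd 1 u) x ^ 2 + rpd 2 (rpd 2 u) x ^ 2
    + rpd 0 (rpd 1 u) x ^ 2 + rpd 1 (rpd 2 u) x ^ 2 + rpd 0 (rpd 2 u) x ^ 2)

/-- Weighted density of the squared gradient plus `l ^ 2` times the squared function. -/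
def gradDensity (l : ℝ) (ρ u : E3 → ℝ) (x : E3) : ℝ :=
  ρ x * ((rpd 0 u x ^ 2 + rpd 1 u x ^ 2 + rpd 2 u x ^ 2) + l ^ 2 * u x ^ 2)

namespace IsTest

variable {U : Set E3} {ρ u : E3 → ℝ}

lemma sq (hu : IsTest U u) : IsTest U (fun x ↦ u x ^ 2) := by
  simpa only [pow_two] using hu.mul hu.contDiff

lemma lapDensity (hu : IsTest U u) (hρ : ContDiff ℝ ∞ ρ) : IsTest U (lapDensity ρ u) :=
  (((((hu.rpd 0).rpd 0).add ((hu.rpd 1).rpd 1)).add ((hu.rpd 2).rpd 2)).sq).mul' hρ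

lemma hessDensity (hu : IsTest U u) (hρ : ContDiff ℝ ∞ ρ) : IsTest U (hessDensity ρ u) :=
  (((((((hu.rpd 0).rpd 0).sq.add ((hu.rpd 1).rpd 1).sq).add ((hu.rpd 2).rpd 2).sq).add
    ((hu.rpd 1).rpd 0).sq).add ((hu.rpd 2).rpd 1).sq).add ((hu.rpd 2).rpd 0).sq).mul' hρ

lemma gradDensity (hu : IsTest U u) (hρ : ContDiff ℝ ∞ ρ) (l : ℝ) :
    IsTest U (gradDensity l ρ u) :=
  ((((hu.rpd 0).sq.add (hu.rpd 1).sq).add (hu.rpd 2).sq).add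
    (hu.sq.mul' contDiff_const)).mul' hρ

end IsTest

lemma carleman_real {U : Set E3} (hU : MeasurableSet U) {u : E3 → ℝ} (hu : IsTest U u)
    {c l r N K : ℝ} (hl : 1 ≤ l) (hK : 0 ≤ K) (hlU : ∀ x ∈ U, 1 ≤ l * (x 2 - r) ^ 2)
    (hNU : ∀ x ∈ U, (x 2 - r) ^ 2 ≤ N) (hKU : ∀ x ∈ U, 1 ≤ K * (x 2 - r) ^ 2) :
    ((12 + 12 * N + K)⁻¹ / l) *
        (∫ x in U, hessDensity (fun x ↦ Real.exp c * Real.exp (l * (x 2 - r) ^ 2)) u x)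
      + ((12 + 12 * N + K)⁻¹ * l) *
        (∫ x in U, gradDensity l (fun x ↦ Real.exp c * Real.exp (l * (x 2 - r) ^ 2)) u x) ≤
    ∫ x in U, lapDensity (fun x ↦ Real.exp c * Real.exp (l * (x 2 - r) ^ 2)) u x := by
  set ρ : E3 → ℝ := fun x ↦ Real.exp c * Real.exp (l * (x 2 - r) ^ 2) with hρ
  have hρs : ContDiff ℝ ∞ ρ := by fun_prop
  set E : E3 → ℝ := fun x ↦ Real.exp (c / 2 + l / 2 * ((x 2 - r) * (x 2 - r))) with hE
  have hEs : ContDiff ℝ ∞ E := by fun_prop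
  have hρE (x : E3) : ρ x = E x ^ 2 := by
    simp only [hρ, hE]
    rw [← Real.exp_add, ← Real.exp_nat_mul]
    push_cast
    ring_nf
  have hw : IsTest U (fun x ↦ E x * u x) := hu.mul' hEs
  have hd : Differentiable ℝ u := hu.contDiff.differentiable (by simp)
  have hd1 (i : Fin 3) : Differentiable ℝ (rpd i u) :=
    (hu.rpd i).contDiff.differentiable (by simp)
  have hEd : Differentiable ℝ E := hEs.differentiable (by simp)
  have hE0 (x : E3) : rpd 0 E x = 0 := by
    rw [hE]
    simp (disch := fun_prop) [rpd_exp, rpd_add, rpd_sub, rpd_mul, rpd_const, rpd_coord]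
  have hE1 (x : E3) : rpd 1 E x = 0 := by
    rw [hE]
    simp (disch := fun_prop) [rpd_exp, rpd_add, rpd_sub, rpd_mul, rpd_const, rpd_coord]
  have hE2 (x : E3) : rpd 2 E x = E x * (l * (x 2 - r)) := by
    rw [hE]
    simp (disch := fun_prop) [rpd_exp, rpd_add, rpd_sub, rpd_mul, rpd_const, rpd_coord]
    ring
  have hw0 : rpd 0 (fun x ↦ E x * u x) = fun x ↦ E x * rpd 0 u x := by
    funext x
    rw [rpd_mul hEd hd, hE0]
    ring
  have hw1 : rpd 1 (fun x ↦ E x * u x) = fun x ↦ E x * rpd 1 u x := by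
    funext x
    rw [rpd_mul hEd hd, hE1]
    ring
  have hw2 : rpd 2 (fun x ↦ E x * u x) = fun x ↦ E x * (rpd 2 u x + l * (x 2 - r) * u x) := by
    funext x
    rw [rpd_mul hEd hd, hE2]
    ring
  obtain ⟨G, hGi, hG0, hG⟩ :=
    setIntegral_carleman_divergence hw l r (6 * (12 + 12 * N + K)⁻¹ / l)
  have hH := (hu.hessDensity hρs).integrable.integrableOn (s := U)
  have hD := (hu.gradDensity hρs l).integrable.integrableOn (s := U)
  have hL := (hu.lapDensity hρs).integrable.integrableOn (s := U)
  have hle := setIntegral_mono_on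
    (((hH.const_mul ((12 + 12 * N + K)⁻¹ / l)).add (hD.const_mul ((12 + 12 * N + K)⁻¹ * l))).add
      hGi) hL hU fun x hx ↦ ?_
  · rwa [integral_add' ((hH.const_mul _).add (hD.const_mul _)) hGi,
      integral_add' (hH.const_mul _) (hD.const_mul _), integral_const_mul, integral_const_mul,
      hG0, add_zero] at hle
  · have h := carleman_pointwise (q := x 2 - r) (w := E x * u x)
      (w0 := rpd 0 (fun x ↦ E x * u x) x) (w1 := rpd 1 (fun x ↦ E x * u x) x)
      (w2 := rpd 2 (fun x ↦ E x * u x) x) (w00 := rpd 0 (rpd 0 (fun x ↦ E x * u x)) x)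
      (w11 := rpd 1 (rpd 1 (fun x ↦ E x * u x)) x) (w22 := rpd 2 (rpd 2 (fun x ↦ E x * u x)) x)
      (w01 := rpd 0 (rpd 1 (fun x ↦ E x * u x)) x) (w12 := rpd 1 (rpd 2 (fun x ↦ E x * u x)) x)
      (w02 := rpd 0 (rpd 2 (fun x ↦ E x * u x)) x) hl (hlU x hx) (hNU x hx) hK (hKU x hx)
    rw [← hG] at h
    have h00 : rpd 0 (rpd 0 (fun x ↦ E x * u x)) x = E x * rpd 0 (rpd 0 u) x := by
      rw [hw0, rpd_mul hEd (hd1 0), hE0]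
      ring
    have h11 : rpd 1 (rpd 1 (fun x ↦ E x * u x)) x = E x * rpd 1 (rpd 1 u) x := by
      rw [hw1, rpd_mul hEd (hd1 1), hE1]
      ring
    have h01 : rpd 0 (rpd 1 (fun x ↦ E x * u x)) x = E x * rpd 0 (rpd 1 u) x := by
      rw [hw1, rpd_mul hEd (hd1 1), hE0]
      ring
    have h02 : rpd 0 (rpd 2 (fun x ↦ E x * u x)) x =
        E x * (rpd 0 (rpd 2 u) x + l * (x 2 - r) * rpd 0 u x) := by
      rw [hw2, rpd_mul hEd (by fun_prop), hE0]
      simp (disch := fun_prop) [rpd_mul, rpd_add, rpd_sub, rpd_const, rpd_coord]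
    have h12 : rpd 1 (rpd 2 (fun x ↦ E x * u x)) x =
        E x * (rpd 1 (rpd 2 u) x + l * (x 2 - r) * rpd 1 u x) := by
      rw [hw2, rpd_mul hEd (by fun_prop), hE1]
      simp (disch := fun_prop) [rpd_mul, rpd_add, rpd_sub, rpd_const, rpd_coord]
    have h22 : rpd 2 (rpd 2 (fun x ↦ E x * u x)) x =
        E x * (rpd 2 (rpd 2 u) x + 2 * l * (x 2 - r) * rpd 2 u x
          + (l ^ 2 * (x 2 - r) ^ 2 + l) * u x) := by
      rw [hw2, rpd_mul hEd (by fun_prop), hE2]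
      simp (disch := fun_prop) [rpd_mul, rpd_add, rpd_sub, rpd_const, rpd_coord]
      ring
    rw [h00, h11, h01, h02, h12, h22, hw0, hw1, hw2] at h
    simp only [Pi.add_apply, hessDensity, gradDensity, lapDensity, hρE]
    refine le_of_eq_of_le ?_ (h.trans_eq ?_) <;> ring

section ComplexValued

variable {U : Set E3} {V : E3 → ℂ}

lemma contDiff_pd (i : Fin 3) (hV : ContDiff ℝ ∞ V) : ContDiff ℝ ∞ (pd i V) :=
  (hV.fderiv_right (m := ∞) (by simp)).clm_apply contDiff_const

lemma rpd_clm_comp (L : ℂ →L[ℝ] ℝ) (i : Fin 3) (hV : ContDiff ℝ ∞ V) :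
    rpd i (fun x ↦ L (V x)) = fun x ↦ L (pd i V x) := by
  funext x
  have h := (L.hasFDerivAt.comp x (hV.differentiable (by simp) x).hasFDerivAt).fderiv
  simp only [Function.comp_def] at h
  simp [rpd, pd, h]

lemma isTest_clm_comp (L : ℂ →L[ℝ] ℝ) (hV : ContDiff ℝ ∞ V) (hc : HasCompactSupport V)
    (hs : tsupport V ⊆ U) : IsTest U (fun x ↦ L (V x)) :=
  ⟨L.contDiff.comp hV, hc.comp_left L.map_zero, (tsupport_comp_subset L.map_zero V).trans hs⟩

lemma norm_sq_eq_clm (z : ℂ) : ‖z‖ ^ 2 = Complex.reCLM z ^ 2 + Complex.imCLM z ^ 2 := by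
  rw [Complex.sq_norm, Complex.normSq_apply]
  simp [pow_two]

lemma lapDensity_re_add_im (ρ : E3 → ℝ) (hV : ContDiff ℝ ∞ V) (x : E3) :
    ρ x * ‖lap V x‖ ^ 2 = lapDensity ρ (fun x ↦ Complex.reCLM (V x)) x
      + lapDensity ρ (fun x ↦ Complex.imCLM (V x)) x := by
  simp only [lapDensity, rpd_clm_comp _ _ hV, rpd_clm_comp _ _ (contDiff_pd _ hV),
    norm_sq_eq_clm, lap, map_add]
  ring

lemma hessDensity_re_add_im (ρ : E3 → ℝ) (hV : ContDiff ℝ ∞ V) (x : E3) :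
    ρ x * (‖pd 0 (pd 0 V) x‖ ^ 2 + ‖pd 1 (pd 1 V) x‖ ^ 2 + ‖pd 2 (pd 2 V) x‖ ^ 2 +
        ‖pd 0 (pd 1 V) x‖ ^ 2 + ‖pd 1 (pd 2 V) x‖ ^ 2 + ‖pd 0 (pd 2 V) x‖ ^ 2) =
      hessDensity ρ (fun x ↦ Complex.reCLM (V x)) x
        + hessDensity ρ (fun x ↦ Complex.imCLM (V x)) x := by
  simp only [hessDensity, rpd_clm_comp _ _ hV, rpd_clm_comp _ _ (contDiff_pd _ hV),
    norm_sq_eq_clm]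
  ring

lemma gradDensity_re_add_im (l : ℝ) (ρ : E3 → ℝ) (hV : ContDiff ℝ ∞ V) (x : E3) :
    ρ x * ((‖pd 0 V x‖ ^ 2 + ‖pd 1 V x‖ ^ 2 + ‖pd 2 V x‖ ^ 2) + l ^ 2 * ‖V x‖ ^ 2) =
      gradDensity l ρ (fun x ↦ Complex.reCLM (V x)) x
        + gradDensity l ρ (fun x ↦ Complex.imCLM (V x)) x := by
  simp only [gradDensity, rpd_clm_comp _ _ hV, norm_sq_eq_clm]
  ring

end ComplexValued

/-- Carleman estimate for the Laplacian with the weight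
`μ_λ(z) = exp(-λ(R+r)²) exp(λ(z-r)²)` on `Ω = (-R,R)×(-R,R)×(-b,b)`. -/
theorem carleman_estimate (R b r : ℝ) (hR : 0 < R) (hb : 0 < b) (hbr : b < r) :
    ∃ (lam₀ C : ℝ), 1 ≤ lam₀ ∧ 0 < C ∧
      ∀ lam : ℝ, lam₀ ≤ lam →
      ∀ V : E3 → ℂ, ContDiff ℝ (⊤ : ℕ∞) V → HasCompactSupport V →
        tsupport V ⊆ {x : E3 | |x 0| < R ∧ |x 1| < R ∧ |x 2| < b} →
        (∫ x in {x : E3 | |x 0| < R ∧ |x 1| < R ∧ |x 2| < b},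
            Real.exp (-lam * (R + r)^2) * Real.exp (lam * (x 2 - r)^2) * ‖lap V x‖^2) ≥
        (C / lam) * (∫ x in {x : E3 | |x 0| < R ∧ |x 1| < R ∧ |x 2| < b},
            Real.exp (-lam * (R + r)^2) * Real.exp (lam * (x 2 - r)^2) *
              (‖pd 0 (pd 0 V) x‖^2 + ‖pd 1 (pd 1 V) x‖^2 + ‖pd 2 (pd 2 V) x‖^2 +
               ‖pd 0 (pd 1 V) x‖^2 + ‖pd 1 (pd 2 V) x‖^2 + ‖pd 0 (pd 2 V) x‖^2)) +
        (C * lam) * (∫ x in {x : E3 | |x 0| < R ∧ |x 1| < R ∧ |x 2| < b},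
            Real.exp (-lam * (R + r)^2) * Real.exp (lam * (x 2 - r)^2) *
              ((‖pd 0 V x‖^2 + ‖pd 1 V x‖^2 + ‖pd 2 V x‖^2) + lam^2 * ‖V x‖^2)) := by
  have hd : 0 < r - b := by linarith
  refine ⟨max 1 ((r - b) ^ 2)⁻¹, (12 + 12 * (r + b) ^ 2 + ((r - b) ^ 2)⁻¹)⁻¹, le_max_left _ _,
    by positivity, fun l hl V hV hc hs ↦ ?_⟩
  set U : Set E3 := {x : E3 | |x 0| < R ∧ |x 1| < R ∧ |x 2| < b} with hUdef
  have hU : MeasurableSet U := by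
    have hm (i : Fin 3) (a : ℝ) : IsOpen {x : E3 | |x i| < a} :=
      isOpen_lt (by fun_prop) continuous_const
    exact ((hm 0 R).inter ((hm 1 R).inter (hm 2 b))).measurableSet
  have hsq (x : E3) (hx : x ∈ U) : (r - b) ^ 2 ≤ (x 2 - r) ^ 2 := by
    have := (abs_lt.1 hx.2.2).2
    nlinarith
  have hl2 : ((r - b) ^ 2)⁻¹ ≤ l := (le_max_right _ _).trans hl
  have hKU (x : E3) (hx : x ∈ U) : 1 ≤ ((r - b) ^ 2)⁻¹ * (x 2 - r) ^ 2 := by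
    rw [inv_mul_eq_div, one_le_div (by positivity)]
    exact hsq x hx
  have hlU (x : E3) (hx : x ∈ U) : 1 ≤ l * (x 2 - r) ^ 2 :=
    (hKU x hx).trans (mul_le_mul_of_nonneg_right hl2 (sq_nonneg _))
  have hNU (x : E3) (hx : x ∈ U) : (x 2 - r) ^ 2 ≤ (r + b) ^ 2 := by
    obtain ⟨h1, h2⟩ := abs_lt.1 hx.2.2
    nlinarith
  have hV' : ContDiff ℝ ∞ V := hV
  have hρ : ContDiff ℝ ∞ (fun x : E3 ↦
      Real.exp (-l * (R + r) ^ 2) * Real.exp (l * (x 2 - r) ^ 2)) := by fun_prop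
  have hre := isTest_clm_comp Complex.reCLM hV' hc hs
  have him := isTest_clm_comp Complex.imCLM hV' hc hs
  have main_re := carleman_real hU hre (c := -l * (R + r) ^ 2) ((le_max_left _ _).trans hl)
    (by positivity) hlU hNU hKU
  have main_im := carleman_real hU him (c := -l * (R + r) ^ 2) ((le_max_left _ _).trans hl)
    (by positivity) hlU hNU hKU
  rw [integral_congr_ae (.of_forall (lapDensity_re_add_im _ hV')),
    integral_congr_ae (.of_forall (hessDensity_re_add_im _ hV')),
    integral_congr_ae (.of_forall (gradDensity_re_add_im l _ hV')),
    integral_add (hre.lapDensity hρ).integrable.integrableOn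
      (him.lapDensity hρ).integrable.integrableOn,
    integral_add (hre.hessDensity hρ).integrable.integrableOn
      (him.hessDensity hρ).integrable.integrableOn,
    integral_add (hre.gradDensity hρ l).integrable.integrableOn
      (him.gradDensity hρ l).integrable.integrableOn]
  linarith
end
end

section
/- Let Ω ⊆ ℝ³ be open, I ⊆ (0,∞) an open interval of wavenumbers, and c : Ω → ℝ (independent of k). Let u, u_i : Ω × I → ℂ be three times continuously differentiable in (x,k) and nowhere vanishing, such that for every k ∈ I, Δ_x u(·,k) + k² c(x) u(·,k) = 0 and Δ_x u_i(·,k) + k² u_i(·,k) = 0 on Ω. Let v : Ω × I → ℂ be three times continuously differentiable with exp(k² v(x,k)) = u(x,k)/u_i(x,k) on Ω × I. Then on Ω × I: Δ_x ∂_k v + 2k² ∇_x v · ∇_x ∂_k v + 2k (∇_x v · ∇_x v) + 2 ∇_x ∂_k v · (∇_x u_i / u_i) + 2 ∇_x v · ∂_k(∇_x u_i / u_i) = 0, where ∇_x and Δ_x act in the spatial variables and the dot product of complex vectors is bilinear (no conjugation). -/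
noncomputable section

/-- Space-wavenumber pairs `(x, k)`. -/
abbrev P : Type := E3 × ℝ

/-- Spatial partial derivative of `W` in the `i`-th coordinate direction. -/
def pdx (i : Fin 3) (W : P → ℂ) (p : P) : ℂ :=
  fderiv ℝ W p (EuclideanSpace.single i 1, 0)

/-- Partial derivative of `W` with respect to the wavenumber `k`. -/
def pdk (W : P → ℂ) (p : P) : ℂ :=
  fderiv ℝ W p (0, 1)

/-- Spatial Laplacian of `W`. -/
def lapx (W : P → ℂ) (p : P) : ℂ := ∑ i : Fin 3, pdx i (pdx i W) p

open Set Filter Topology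

section DirectionalDerivative

variable {E : Type*} [NormedAddCommGroup E] [NormedSpace ℝ E]

theorem ContDiffOn.fderiv_apply_const_of_isOpen {D : Set E} (hD : IsOpen D) {W : E → ℂ}
    {m n : WithTop ℕ∞} (hW : ContDiffOn ℝ n W D) (hmn : m + 1 ≤ n) (e : E) :
    ContDiffOn ℝ m (fun q => fderiv ℝ W q e) D :=
  (hW.fderiv_of_isOpen hD hmn).clm_apply contDiffOn_const

theorem fderiv_congr_of_eqOn {D : Set E} (hD : IsOpen D) {f g : E → ℂ} (h : EqOn f g D)
    {p : E} (hp : p ∈ D) : fderiv ℝ f p = fderiv ℝ g p :=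
  (h.eventuallyEq_of_mem (hD.mem_nhds hp)).fderiv_eq

theorem fderiv_fderiv_apply_comm {D : Set E} (hD : IsOpen D) {W : E → ℂ}
    (hW : ContDiffOn ℝ 2 W D) {p : E} (hp : p ∈ D) (e f : E) :
    fderiv ℝ (fun q => fderiv ℝ W q e) p f = fderiv ℝ (fun q => fderiv ℝ W q f) p e := by
  have hd : DifferentiableAt ℝ (fderiv ℝ W) p :=
    ((hW.fderiv_of_isOpen (m := 1) hD (by norm_num)).contDiffAt
      (hD.mem_nhds hp)).differentiableAt (by norm_num)
  have hs : IsSymmSndFDerivAt ℝ W p :=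
    (hW.contDiffAt (hD.mem_nhds hp)).isSymmSndFDerivAt (by simp)
  rw [fderiv_clm_apply hd (differentiableAt_const e),
    fderiv_clm_apply hd (differentiableAt_const f)]
  simpa using hs f e

theorem fderiv_mul_apply {f g : E → ℂ} {p : E} (hf : DifferentiableAt ℝ f p)
    (hg : DifferentiableAt ℝ g p) (e : E) :
    fderiv ℝ (fun q => f q * g q) p e = f p * fderiv ℝ g p e + fderiv ℝ f p e * g p := by
  rw [fderiv_fun_mul hf hg]
  simp [mul_comm]

theorem fderiv_add_apply {f g : E → ℂ} {p : E} (hf : DifferentiableAt ℝ f p)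
    (hg : DifferentiableAt ℝ g p) (e : E) :
    fderiv ℝ (fun q => f q + g q) p e = fderiv ℝ f p e + fderiv ℝ g p e := by
  rw [fderiv_fun_add hf hg]
  simp

theorem fderiv_cexp_apply {f : E → ℂ} {p : E} (hf : DifferentiableAt ℝ f p) (e : E) :
    fderiv ℝ (fun q => Complex.exp (f q)) p e = Complex.exp (f p) * fderiv ℝ f p e := by
  rw [hf.hasFDerivAt.cexp.fderiv]
  simp

theorem hasFDerivAt_ofReal_snd_sq (p : E × ℝ) :
    HasFDerivAt (fun q : E × ℝ => (q.2 : ℂ) ^ 2)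
      ((2 * (p.2 : ℂ)) • (Complex.ofRealCLM.comp (ContinuousLinearMap.snd ℝ E ℝ))) p := by
  have h : HasFDerivAt (fun q : E × ℝ => (q.2 : ℂ))
      (Complex.ofRealCLM.comp (ContinuousLinearMap.snd ℝ E ℝ)) p :=
    (Complex.ofRealCLM.comp (ContinuousLinearMap.snd ℝ E ℝ)).hasFDerivAt
  simpa using h.pow 2

theorem fderiv_ofReal_snd_sq_apply (p e : E × ℝ) :
    fderiv ℝ (fun q : E × ℝ => (q.2 : ℂ) ^ 2) p e = 2 * (p.2 : ℂ) * (e.2 : ℂ) := by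
  rw [(hasFDerivAt_ofReal_snd_sq p).fderiv]
  simp

theorem fderiv_apply_zero_one_eq_zero {F : E × ℝ → ℂ} {x : E} {k : ℝ} {a : ℂ}
    (hF : DifferentiableAt ℝ F (x, k)) (h : ∀ᶠ t in 𝓝 k, F (x, t) = a) :
    fderiv ℝ F (x, k) (0, 1) = 0 := by
  have hl : HasDerivAt (fun t : ℝ => (x, t)) ((0 : E), (1 : ℝ)) k :=
    (hasDerivAt_const k x).prodMk (hasDerivAt_id k)
  have h1 : HasDerivAt (fun t => F (x, t)) (fderiv ℝ F (x, k) (0, 1)) k :=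
    hF.hasFDerivAt.comp_hasDerivAt k hl
  exact h1.unique ((hasDerivAt_const k a).congr_of_eventuallyEq h)

/-- Second derivative along a spatial direction `e` of `w * exp (k² v)`. -/
theorem fderiv_fderiv_mul_cexp {D : Set (E × ℝ)} (hD : IsOpen D) {u w v : E × ℝ → ℂ}
    (hw : ContDiffOn ℝ 2 w D) (hv : ContDiffOn ℝ 2 v D)
    (hu : EqOn u (fun q => w q * Complex.exp ((q.2 : ℂ) ^ 2 * v q)) D)
    {p e : E × ℝ} (hp : p ∈ D) (he : e.2 = 0) :
    fderiv ℝ (fun q => fderiv ℝ u q e) p e =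
      Complex.exp ((p.2 : ℂ) ^ 2 * v p) *
        (fderiv ℝ (fun q => fderiv ℝ w q e) p e
          + (p.2 : ℂ) ^ 2 * (2 * (fderiv ℝ w p e * fderiv ℝ v p e)
            + w p * fderiv ℝ (fun q => fderiv ℝ v q e) p e
            + (p.2 : ℂ) ^ 2 * (w p * (fderiv ℝ v p e * fderiv ℝ v p e)))) := by
  have dk : ∀ q : E × ℝ, DifferentiableAt ℝ (fun q : E × ℝ => (q.2 : ℂ) ^ 2) q :=
    fun q => (hasFDerivAt_ofReal_snd_sq q).differentiableAt
  have dw : ∀ q ∈ D, DifferentiableAt ℝ w q := fun q hq =>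
    (hw.contDiffAt (hD.mem_nhds hq)).differentiableAt (by norm_num)
  have dv : ∀ q ∈ D, DifferentiableAt ℝ v q := fun q hq =>
    (hv.contDiffAt (hD.mem_nhds hq)).differentiableAt (by norm_num)
  have dw' : DifferentiableAt ℝ (fun q => fderiv ℝ w q e) p :=
    ((hw.fderiv_apply_const_of_isOpen (m := 1) hD (by norm_num) e).contDiffAt
      (hD.mem_nhds hp)).differentiableAt (by norm_num)
  have dv' : DifferentiableAt ℝ (fun q => fderiv ℝ v q e) p :=
    ((hv.fderiv_apply_const_of_isOpen (m := 1) hD (by norm_num) e).contDiffAt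
      (hD.mem_nhds hp)).differentiableAt (by norm_num)
  have dE : ∀ q ∈ D, DifferentiableAt ℝ (fun q => Complex.exp ((q.2 : ℂ) ^ 2 * v q)) q :=
    fun q hq => ((dk q).mul (dv q hq)).cexp
  have hE : ∀ q ∈ D, fderiv ℝ (fun q => Complex.exp ((q.2 : ℂ) ^ 2 * v q)) q e =
      Complex.exp ((q.2 : ℂ) ^ 2 * v q) * ((q.2 : ℂ) ^ 2 * fderiv ℝ v q e) := by
    intro q hq
    rw [fderiv_cexp_apply ((dk q).fun_mul (dv q hq)), fderiv_mul_apply (dk q) (dv q hq),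
      fderiv_ofReal_snd_sq_apply, he]
    simp
  have h1 : EqOn (fun q => fderiv ℝ u q e) (fun q => Complex.exp ((q.2 : ℂ) ^ 2 * v q) *
      (fderiv ℝ w q e + (q.2 : ℂ) ^ 2 * (w q * fderiv ℝ v q e))) D := by
    intro q hq
    simp only
    rw [fderiv_congr_of_eqOn hD hu hq, fderiv_mul_apply (dw q hq) (dE q hq), hE q hq]
    ring
  have dwv := (dw p hp).fun_mul dv'
  have dkwv := (dk p).fun_mul dwv
  rw [fderiv_congr_of_eqOn hD h1 hp, fderiv_mul_apply (dE p hp) (dw'.fun_add dkwv), hE p hp,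
    fderiv_add_apply dw' dkwv, fderiv_mul_apply (dk p) dwv, fderiv_mul_apply (dw p hp) dv',
    fderiv_ofReal_snd_sq_apply, he]
  push_cast
  ring

end DirectionalDerivative

/-- The third-order PDE, free of the coefficient `c`, obtained by differentiating the
quasilinear equation for `v = (1/k²) log(u/u_i)` with respect to the wavenumber `k`. -/
theorem third_order_pde (Ω : Set E3) (hΩ : IsOpen Ω)
    (ka kb : ℝ) (hka : 0 < ka) (hkab : ka < kb) (c : E3 → ℝ)
    (u ui v : P → ℂ)
    (hu : ContDiffOn ℝ 3 u (Ω ×ˢ Set.Ioo ka kb))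
    (hui : ContDiffOn ℝ 3 ui (Ω ×ˢ Set.Ioo ka kb))
    (hv : ContDiffOn ℝ 3 v (Ω ×ˢ Set.Ioo ka kb))
    (hu0 : ∀ p ∈ Ω ×ˢ Set.Ioo ka kb, u p ≠ 0)
    (hui0 : ∀ p ∈ Ω ×ˢ Set.Ioo ka kb, ui p ≠ 0)
    (hHelm : ∀ x ∈ Ω, ∀ k ∈ Set.Ioo ka kb,
        lapx u (x, k) + (k : ℂ)^2 * (c x : ℂ) * u (x, k) = 0)
    (hHelmi : ∀ x ∈ Ω, ∀ k ∈ Set.Ioo ka kb,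
        lapx ui (x, k) + (k : ℂ)^2 * ui (x, k) = 0)
    (hvdef : ∀ x ∈ Ω, ∀ k ∈ Set.Ioo ka kb,
        Complex.exp ((k : ℂ)^2 * v (x, k)) = u (x, k) / ui (x, k)) :
    ∀ x ∈ Ω, ∀ k ∈ Set.Ioo ka kb,
      lapx (pdk v) (x, k)
        + 2 * (k : ℂ)^2 * (∑ i : Fin 3, pdx i v (x, k) * pdx i (pdk v) (x, k))
        + 2 * (k : ℂ) * (∑ i : Fin 3, pdx i v (x, k) * pdx i v (x, k))
        + 2 * (∑ i : Fin 3, pdx i (pdk v) (x, k) * (pdx i ui (x, k) / ui (x, k)))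
        + 2 * (∑ i : Fin 3, pdx i v (x, k) * pdk (fun q => pdx i ui q / ui q) (x, k))
        = 0 := by
  intro x hx k hk
  set D : Set P := Ω ×ˢ Set.Ioo ka kb
  have hD : IsOpen D := hΩ.prod isOpen_Ioo
  have hp : ((x, k) : P) ∈ D := ⟨hx, hk⟩
  have hu_eq : EqOn u (fun q => ui q * Complex.exp ((q.2 : ℂ) ^ 2 * v q)) D := by
    rintro ⟨y, t⟩ hq
    simp only
    rw [hvdef y hq.1 t hq.2, mul_div_cancel₀ _ (hui0 _ hq)]
  have quasi : ∀ q ∈ D, (∑ i : Fin 3, (pdx i (pdx i v) q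
      + ((q.2 : ℂ) ^ 2 * (pdx i v q * pdx i v q)
        + 2 * (pdx i v q * (pdx i ui q / ui q))))) = 1 - (c q.1 : ℂ) := by
    rintro ⟨y, t⟩ hq
    have ht : (t : ℂ) ≠ 0 := by
      exact_mod_cast (hka.trans hq.2.1).ne'
    have hw0 := hui0 _ hq
    have hE := Complex.exp_ne_zero ((t : ℂ) ^ 2 * v (y, t))
    have h1 := hHelm y hq.1 t hq.2
    have h2 := hHelmi y hq.1 t hq.2
    have h3 : ∀ i : Fin 3, pdx i (pdx i u) (y, t) =
        Complex.exp ((t : ℂ) ^ 2 * v (y, t)) * (pdx i (pdx i ui) (y, t)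
          + (t : ℂ) ^ 2 * (2 * (pdx i ui (y, t) * pdx i v (y, t))
            + ui (y, t) * pdx i (pdx i v) (y, t)
            + (t : ℂ) ^ 2 * (ui (y, t) * (pdx i v (y, t) * pdx i v (y, t))))) := fun i =>
      fderiv_fderiv_mul_cexp hD (hui.of_le (by norm_num)) (hv.of_le (by norm_num)) hu_eq hq
        (e := (EuclideanSpace.single i 1, 0)) rfl
    simp only [lapx, Fin.sum_univ_three, h3, hu_eq hq] at h1 h2 ⊢
    field_simp
    apply mul_left_cancel₀ (mul_ne_zero hE (pow_ne_zero 2 ht))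
    linear_combination h1 - Complex.exp ((t : ℂ) ^ 2 * v (y, t)) * h2
  have diff_of : ∀ {W : P → ℂ}, ContDiffOn ℝ 1 W D → DifferentiableAt ℝ W (x, k) := fun hW =>
    (hW.contDiffAt (hD.mem_nhds hp)).differentiableAt (by norm_num)
  have cv : ∀ i, ContDiffOn ℝ 2 (pdx i v) D := fun i =>
    hv.fderiv_apply_const_of_isOpen hD (by norm_num) _
  have dv : ∀ i, DifferentiableAt ℝ (pdx i v) (x, k) := fun i =>
    diff_of ((cv i).of_le (by norm_num))
  have dvv : ∀ i, DifferentiableAt ℝ (pdx i (pdx i v)) (x, k) := fun i =>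
    diff_of ((cv i).fderiv_apply_const_of_isOpen hD (by norm_num) _)
  have dr : ∀ i, DifferentiableAt ℝ (fun q => pdx i ui q / ui q) (x, k) := fun i =>
    have h1 : DifferentiableAt ℝ (pdx i ui) (x, k) :=
      diff_of (hui.fderiv_apply_const_of_isOpen hD (by norm_num) _ : ContDiffOn ℝ 1 _ D)
    have h2 : DifferentiableAt ℝ ui (x, k) := diff_of (hui.of_le (by norm_num))
    by simpa only [div_eq_mul_inv] using h1.fun_mul (h2.fun_inv (hui0 _ hp))
  have dk : DifferentiableAt ℝ (fun q : P => (q.2 : ℂ) ^ 2) (x, k) :=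
    (hasFDerivAt_ofReal_snd_sq _).differentiableAt
  have comm1 : ∀ i, EqOn (pdk (pdx i v)) (pdx i (pdk v)) D := fun i q hq =>
    fderiv_fderiv_apply_comm hD (hv.of_le (by norm_num)) hq _ _
  have comm2 : ∀ i, pdk (pdx i (pdx i v)) (x, k) = pdx i (pdx i (pdk v)) (x, k) := fun i =>
    (fderiv_fderiv_apply_comm hD (cv i) hp _ _).trans
      (DFunLike.congr_fun (fderiv_congr_of_eqOn hD (comm1 i) hp) _)
  have dsq : ∀ i, DifferentiableAt ℝ (fun q : P => (q.2 : ℂ) ^ 2 * (pdx i v q * pdx i v q))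
      (x, k) := fun i => dk.fun_mul ((dv i).fun_mul (dv i))
  have dcr : ∀ i, DifferentiableAt ℝ (fun q : P => 2 * (pdx i v q * (pdx i ui q / ui q)))
      (x, k) := fun i => ((dv i).fun_mul (dr i)).const_mul 2
  have dterm := fun i => (dvv i).fun_add ((dsq i).fun_add (dcr i))
  have hterm : ∀ i, fderiv ℝ (fun q : P => pdx i (pdx i v) q
      + ((q.2 : ℂ) ^ 2 * (pdx i v q * pdx i v q)
        + 2 * (pdx i v q * (pdx i ui q / ui q)))) (x, k) (0, 1) =
      pdx i (pdx i (pdk v)) (x, k)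
        + 2 * (k : ℂ) ^ 2 * (pdx i v (x, k) * pdx i (pdk v) (x, k))
        + 2 * (k : ℂ) * (pdx i v (x, k) * pdx i v (x, k))
        + 2 * (pdx i (pdk v) (x, k) * (pdx i ui (x, k) / ui (x, k)))
        + 2 * (pdx i v (x, k) * pdk (fun q => pdx i ui q / ui q) (x, k)) := by
    intro i
    rw [← comm2 i, ← comm1 i hp, fderiv_add_apply (dvv i) ((dsq i).fun_add (dcr i)),
      fderiv_add_apply (dsq i) (dcr i), fderiv_mul_apply dk ((dv i).fun_mul (dv i)),
      fderiv_mul_apply (dv i) (dv i),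
      fderiv_mul_apply (differentiableAt_const (2 : ℂ)) ((dv i).fun_mul (dr i)),
      fderiv_mul_apply (dv i) (dr i), fderiv_ofReal_snd_sq_apply]
    simp only [pdk, fderiv_fun_const, Pi.zero_apply, zero_apply, Complex.ofReal_one]
    ring
  have key := fderiv_apply_zero_one_eq_zero (a := 1 - (c x : ℂ))
    (DifferentiableAt.fun_sum (u := Finset.univ) fun i _ => dterm i)
    (by
      filter_upwards [isOpen_Ioo.mem_nhds hk] with t ht
      exact quasi (x, t) ⟨hx, ht⟩)
  rw [fderiv_fun_sum fun i _ => dterm i, sum_apply] at key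
  simp only [hterm, Finset.sum_add_distrib, ← Finset.mul_sum] at key
  exact key
end
end

section
/- Let 0 < k̲ < k̄, let φ_m(k) = k^{m−1} e^{k − (k̄ + k̲)/2} for m ≥ 1, and let N ≥ 1. Suppose Ψ_1, …, Ψ_N : [k̲, k̄] → ℝ are continuously differentiable functions that are orthonormal with respect to the inner product ⟨f, g⟩ = ∫_{k̲}^{k̄} f(k) g(k) dk, and such that for every m ≤ N, span{Ψ_1, …, Ψ_m} = span{φ_1, …, φ_m} (as subspaces of the space of functions on [k̲, k̄]). Then for every n ≤ N, the derivative Ψ_n′ satisfies Ψ_n′ − Ψ_n ∈ span{Ψ_1, …, Ψ_{n−1}} (with the convention that this span is {0} when n = 1, so that Ψ_1′ = Ψ_1). -/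
open MeasureTheory

noncomputable section

/-- `φ_m(k) = k^(m-1) exp(k - (k̄+k̲)/2)`. -/
def phi (ka kb : ℝ) (m : ℕ) (k : ℝ) : ℝ := k ^ (m - 1) * Real.exp (k - (kb + ka) / 2)

/-- Restriction of a function on `ℝ` to the interval `[ka, kb]`. -/
def res (ka kb : ℝ) (f : ℝ → ℝ) : Set.Icc ka kb → ℝ := fun x => f x

/-- The relation `φ_m' = φ_m + (m-1) φ_{m-1}`. -/
theorem hasDerivAt_phi (ka kb : ℝ) (m : ℕ) (k : ℝ) :
    HasDerivAt (phi ka kb m) (phi ka kb m k + ((m - 1 : ℕ) : ℝ) * phi ka kb (m - 1) k) k := by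
  have hexp : HasDerivAt (fun k : ℝ => Real.exp (k - (kb + ka) / 2))
      (Real.exp (k - (kb + ka) / 2)) k := by
    simpa using ((hasDerivAt_id k).sub_const ((kb + ka) / 2)).exp
  refine HasDerivAt.congr_deriv (f := phi ka kb m) ((hasDerivAt_pow (m - 1) k).mul hexp) ?_
  simp only [phi]
  ring

/-- Every element of `span{φ_1, …, φ_n}` is the restriction of a differentiable function `F`
with `F' - F ∈ span{φ_1, …, φ_{n-1}}`. -/
theorem exists_hasDerivAt_of_mem_span_phi (ka kb : ℝ) (n : ℕ) (f : Set.Icc ka kb → ℝ)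
    (hf : f ∈ Submodule.span ℝ ((fun j => res ka kb (phi ka kb j)) '' Set.Icc 1 n)) :
    ∃ F G : ℝ → ℝ, res ka kb F = f ∧ (∀ k, HasDerivAt F (G k) k) ∧
      res ka kb (fun k => G k - F k) ∈
        Submodule.span ℝ ((fun j => res ka kb (phi ka kb j)) '' Set.Icc 1 (n - 1)) := by
  induction hf using Submodule.span_induction with
  | mem f hf =>
    obtain ⟨j, ⟨hj1, hjn⟩, rfl⟩ := hf
    refine ⟨phi ka kb j, _, rfl, hasDerivAt_phi ka kb j, ?_⟩
    have heq : res ka kb (fun k =>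
        phi ka kb j k + ((j - 1 : ℕ) : ℝ) * phi ka kb (j - 1) k - phi ka kb j k) =
        ((j - 1 : ℕ) : ℝ) • res ka kb (phi ka kb (j - 1)) := by
      ext x
      simp [res]
    rw [heq]
    rcases hj1.eq_or_lt with rfl | hj
    · simp
    · exact Submodule.smul_mem _ _ (Submodule.subset_span ⟨j - 1, ⟨by omega, by omega⟩, rfl⟩)
  | zero =>
    refine ⟨fun _ => 0, fun _ => 0, rfl, fun k => hasDerivAt_const k 0, ?_⟩
    convert Submodule.zero_mem _
    ext x
    simp [res]
  | add f g _ _ hf hg =>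
    obtain ⟨F₁, G₁, rfl, hd₁, hs₁⟩ := hf
    obtain ⟨F₂, G₂, rfl, hd₂, hs₂⟩ := hg
    refine ⟨F₁ + F₂, G₁ + G₂, rfl, fun k => (hd₁ k).add (hd₂ k), ?_⟩
    convert Submodule.add_mem _ hs₁ hs₂ using 1
    ext x
    simp only [res, Pi.add_apply]
    ring
  | smul c f _ hf =>
    obtain ⟨F, G, rfl, hd, hs⟩ := hf
    refine ⟨c • F, c • G, rfl, fun k => (hd k).const_smul c, ?_⟩
    convert Submodule.smul_mem _ c hs using 1
    ext x
    simp only [res, Pi.smul_apply, smul_eq_mul]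
    ring

/-- For the Gram–Schmidt orthonormalization `Ψ_n` of the family `φ_n`, the derivative
satisfies `Ψ_n' − Ψ_n ∈ span{Ψ_1, …, Ψ_{n−1}}` (so in particular `Ψ_1' = Ψ_1`). -/
theorem psi_deriv_structure (ka kb : ℝ) (h0 : 0 < ka) (hab : ka < kb)
    (N : ℕ) (hN : 1 ≤ N) (Ψ DΨ : ℕ → ℝ → ℝ)
    (hdiff : ∀ n, 1 ≤ n → n ≤ N → ∀ k ∈ Set.Icc ka kb,
        HasDerivWithinAt (Ψ n) (DΨ n k) (Set.Icc ka kb) k)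
    (hcont : ∀ n, 1 ≤ n → n ≤ N → ContinuousOn (DΨ n) (Set.Icc ka kb))
    (horth : ∀ m, 1 ≤ m → m ≤ N → ∀ n, 1 ≤ n → n ≤ N →
        (∫ k in Set.Ioo ka kb, Ψ m k * Ψ n k) = if m = n then 1 else 0)
    (hspan : ∀ m, 1 ≤ m → m ≤ N →
        Submodule.span ℝ ((fun j => res ka kb (Ψ j)) '' Set.Icc 1 m) =
        Submodule.span ℝ ((fun j => res ka kb (phi ka kb j)) '' Set.Icc 1 m)) :
    ∀ n, 1 ≤ n → n ≤ N →
      res ka kb (fun k => DΨ n k - Ψ n k) ∈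
        Submodule.span ℝ ((fun j => res ka kb (Ψ j)) '' Set.Icc 1 (n - 1)) := by
  intro n hn1 hnN
  have hmem : res ka kb (Ψ n) ∈
      Submodule.span ℝ ((fun j => res ka kb (phi ka kb j)) '' Set.Icc 1 n) := by
    rw [← hspan n hn1 hnN]
    exact Submodule.subset_span ⟨n, ⟨hn1, le_rfl⟩, rfl⟩
  obtain ⟨F, G, hF, hFG, hs⟩ := exists_hasDerivAt_of_mem_span_phi ka kb n _ hmem
  have hFΨ : ∀ k ∈ Set.Icc ka kb, F k = Ψ n k := fun k hk => congrFun hF ⟨k, hk⟩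
  have hG : ∀ k ∈ Set.Icc ka kb, G k = DΨ n k := fun k hk =>
    (uniqueDiffOn_Icc hab k hk).eq_deriv _
      ((hFG k).hasDerivWithinAt.congr (fun y hy => (hFΨ y hy).symm) (hFΨ k hk).symm)
      (hdiff n hn1 hnN k hk)
  have heq : res ka kb (fun k => DΨ n k - Ψ n k) = res ka kb (fun k => G k - F k) := by
    ext ⟨k, hk⟩
    simp only [res, hG k hk, hFΨ k hk]
  rw [heq]
  rcases hn1.eq_or_lt with rfl | hn
  · simpa using hs
  · rwa [hspan (n - 1) (by omega) (by omega)]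
end
end
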